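/- arXiv:2002.09762 — 2 statements merged into one kernel-verified Lean document; each statement's English description precedes it below -/
import Mathlib

section
/- For all real numbers a, b with 0 ≤ a ≤ π and 0 ≤ b ≤ π, one has arccos((cos a + cos b)/2) ≤ √((a² + b²)/2). -/
open Real

lemma aux_sin_ratio (x y : ℝ) (hx : 0 ≤ x) (hxy : x ≤ y) (hy : y ≤ π) (hy0 : 0 < y) :
    x * Real.sin y ≤ y * Real.sin x := by
  have m0 : (0 : ℝ) ∈ Set.Icc 0 π := ⟨le_refl 0, pi_pos.le⟩
  have my : y ∈ Set.Icc 0 π := ⟨hy0.le, hy⟩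
  have e1 : 0 ≤ 1 - x / y := by rw [sub_nonneg, div_le_one hy0]; exact hxy
  have e2 : 0 ≤ x / y := by positivity
  have h := strictConcaveOn_sin_Icc.concaveOn.2 m0 my e1 e2 (by ring)
  simp only [smul_eq_mul, Real.sin_zero, mul_zero, zero_add] at h
  rw [div_mul_cancel₀ _ hy0.ne', div_mul_eq_mul_div, div_le_iff₀ hy0] at h
  linarith

lemma aux_tangent (x c : ℝ) (hx : 0 ≤ x) (hxp : x ≤ π) (hc : 0 < c) (hcp : c ≤ π) :
    Real.cos c + (Real.sin c / c) * c ^ 2 / 2 ≤ Real.cos x + (Real.sin c / c) * x ^ 2 / 2 := by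
  set k := Real.sin c / c with hk
  have hd : ∀ y, HasDerivAt (fun y : ℝ => Real.cos y + k * y ^ 2 / 2) (-Real.sin y + k * y) y := by
    intro y
    have h := (Real.hasDerivAt_cos y).add ((((hasDerivAt_id y).pow 2).const_mul k).div_const 2)
    refine h.congr_deriv ?_
    simp
    ring
  have hcont : Continuous (fun y : ℝ => Real.cos y + k * y ^ 2 / 2) := by fun_prop
  rcases le_total x c with h | h
  · refine antitoneOn_of_deriv_nonpos (convex_Icc 0 c) hcont.continuousOn
      (fun y _ => (hd y).differentiableAt.differentiableWithinAt) ?_ ⟨hx, h⟩ ⟨hc.le, le_refl c⟩ h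
    intro y hy
    rw [interior_Icc] at hy
    rw [(hd y).deriv, hk, div_mul_eq_mul_div]
    have := aux_sin_ratio y c hy.1.le hy.2.le hcp hc
    have : Real.sin c * y / c ≤ Real.sin y := by rw [div_le_iff₀ hc]; linarith
    linarith
  · refine monotoneOn_of_deriv_nonneg (convex_Icc c π) hcont.continuousOn
      (fun y _ => (hd y).differentiableAt.differentiableWithinAt) ?_ ⟨le_refl c, hcp⟩ ⟨h, hxp⟩ h
    intro y hy
    rw [interior_Icc] at hy
    rw [(hd y).deriv, hk, div_mul_eq_mul_div]
    have := aux_sin_ratio c y hc.le hy.1.le hy.2.le (hc.trans hy.1)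
    have : Real.sin y ≤ Real.sin c * y / c := by rw [le_div_iff₀ hc]; linarith
    linarith

/-- For `a, b ∈ [0, π]` one has
`arccos ((cos a + cos b)/2) ≤ √((a² + b²)/2)`; i.e. the natural map from the rescaled
`ℓ²`-product into the spherical join at level `t₁ = t₂ = π/4` is `1`-Lipschitz. -/
theorem arccos_avg_cos_le_sqrt_avg_sq (a b : ℝ) (ha0 : 0 ≤ a) (haπ : a ≤ π)
    (hb0 : 0 ≤ b) (hbπ : b ≤ π) :
    Real.arccos ((Real.cos a + Real.cos b) / 2) ≤ Real.sqrt ((a ^ 2 + b ^ 2) / 2) := by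
  have hsq : Real.sqrt ((a ^ 2 + b ^ 2) / 2) ^ 2 = (a ^ 2 + b ^ 2) / 2 :=
    Real.sq_sqrt (by positivity)
  have hc0 : 0 ≤ Real.sqrt ((a ^ 2 + b ^ 2) / 2) := Real.sqrt_nonneg _
  have hcp : Real.sqrt ((a ^ 2 + b ^ 2) / 2) ≤ π := by
    apply Real.sqrt_le_iff.2 ⟨pi_pos.le, ?_⟩
    nlinarith
  generalize Real.sqrt ((a ^ 2 + b ^ 2) / 2) = c at *
  rcases hc0.eq_or_lt with h | h
  · subst h
    have h1 : a = 0 := by nlinarith [sq_nonneg a, sq_nonneg b]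
    have h2 : b = 0 := by nlinarith [sq_nonneg a, sq_nonneg b]
    subst h1 h2
    simp
  · have h1 := aux_tangent a c ha0 haπ h hcp
    have h2 := aux_tangent b c hb0 hbπ h hcp
    rw [hsq] at h1 h2
    rw [← Real.arccos_cos hc0 hcp]
    apply Real.arccos_le_arccos
    linarith
end

section
/- Let a < b, λ > 0, s ≥ 0, and let ℓ : [a,b] → [0,∞) be a Lipschitz function such that for almost every t ∈ (a,b) at which ℓ is differentiable and ℓ(t) > 0 one has ℓ′(t) ≤ λ·ℓ(t) + 2s/ℓ(t). Then ℓ(t)² + 2s/λ ≤ (ℓ(a)² + 2s/λ)·exp(2λ(t−a)) for every t ∈ [a,b]. -/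
open Real MeasureTheory Set

/-- Gronwall-type integrated form of the distance estimate: if a
nonnegative Lipschitz function `ℓ` on `[a,b]` satisfies `ℓ' ≤ λ·ℓ + 2s/ℓ` at almost every
point of differentiability where `ℓ > 0`, then
`ℓ(t)² + 2s/λ ≤ (ℓ(a)² + 2s/λ)·exp (2λ(t-a))` on `[a,b]`. -/
theorem gronwall_distance_estimate (a b lam s : ℝ) (hab : a < b) (hlam : 0 < lam)
    (hs : 0 ≤ s) (ℓ : ℝ → ℝ) (hLip : ∃ L : NNReal, LipschitzOnWith L ℓ (Set.Icc a b))
    (hnn : ∀ t ∈ Set.Icc a b, 0 ≤ ℓ t)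
    (hderiv : ∀ᵐ t ∂volume, t ∈ Set.Ioo a b → DifferentiableAt ℝ ℓ t → 0 < ℓ t →
      deriv ℓ t ≤ lam * ℓ t + 2 * s / ℓ t) :
    ∀ t ∈ Set.Icc a b,
      ℓ t ^ 2 + 2 * s / lam ≤ (ℓ a ^ 2 + 2 * s / lam) * Real.exp (2 * lam * (t - a)) := by
  intro t ht
  obtain ⟨L, hL⟩ := hLip
  have hl : AbsolutelyContinuousOnInterval ℓ a t := by
    apply LipschitzOnWith.absolutelyContinuousOnInterval (K := L)
    rw [uIcc_of_le ht.1]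
    exact hL.mono (Icc_subset_Icc_right ht.2)
  have hc : AbsolutelyContinuousOnInterval (fun _ : ℝ => 2 * s / lam) a t :=
    ContDiffOn.absolutelyContinuousOnInterval contDiffOn_const
  have he : AbsolutelyContinuousOnInterval
      (fun x : ℝ => Real.exp (-(2 * lam * (x - a)))) a t := by
    apply ContDiffOn.absolutelyContinuousOnInterval
    apply ContDiff.contDiffOn
    fun_prop
  have hg : AbsolutelyContinuousOnInterval
      (fun x => (ℓ x * ℓ x + 2 * s / lam) * Real.exp (-(2 * lam * (x - a)))) a t :=
    ((hl.mul hl).add hc).mul he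
  have hint := hg.integral_deriv_eq_sub
  have hle : ∫ x in a..t,
      deriv (fun x => (ℓ x * ℓ x + 2 * s / lam) * Real.exp (-(2 * lam * (x - a)))) x ≤ 0 := by
    rw [intervalIntegral.integral_of_le ht.1, integral_Ioc_eq_integral_Ioo]
    apply integral_nonpos_of_ae
    rw [Filter.EventuallyLE, ae_restrict_iff' measurableSet_Ioo]
    filter_upwards [hderiv, hl.ae_differentiableAt] with x hx hd hxm
    have hxI : x ∈ Set.Ioo a b := ⟨hxm.1, hxm.2.trans_le ht.2⟩
    have hdx : DifferentiableAt ℝ ℓ x := hd (by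
      rw [uIcc_of_le ht.1]; exact ⟨hxm.1.le, hxm.2.le⟩)
    have h1 := hdx.hasDerivAt
    have h2 : HasDerivAt (fun x : ℝ => -(2 * lam * (x - a))) (-(2 * lam * 1)) x :=
      (((hasDerivAt_id x).sub_const a).const_mul (2 * lam)).neg
    have h3 := ((h1.mul h1).add_const (2 * s / lam)).mul h2.exp
    have h4 : deriv (fun x => (ℓ x * ℓ x + 2 * s / lam) *
      Real.exp (-(2 * lam * (x - a)))) x = _ := h3.deriv
    have key : 2 * (ℓ x * deriv ℓ x) ≤ 2 * lam * (ℓ x * ℓ x) + 4 * s := by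
      rcases (hnn x ⟨hxI.1.le, hxI.2.le⟩).eq_or_lt with h0 | h0
      · rw [← h0]; nlinarith
      · have h5 := mul_le_mul_of_nonneg_left (hx hxI hdx h0) h0.le
        have h6 : ℓ x * (lam * ℓ x + 2 * s / ℓ x) = lam * (ℓ x * ℓ x) + 2 * s := by
          field_simp
        linarith
    have h7 : lam * (2 * s / lam) = 2 * s := by field_simp
    have h8 : 2 * (ℓ x * deriv ℓ x) - 2 * lam * (ℓ x * ℓ x + 2 * s / lam) ≤ 0 := by
      nlinarith
    have h9 := mul_nonpos_of_nonpos_of_nonneg h8 (Real.exp_pos (-(2 * lam * (x - a)))).le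
    rw [h4]
    simp only [Pi.mul_apply, Pi.zero_apply]
    linarith
  rw [hint] at hle
  simp only [sub_self, mul_zero, neg_zero, Real.exp_zero, mul_one] at hle
  rw [Real.exp_neg, ← div_eq_mul_inv, sub_nonpos, div_le_iff₀ (Real.exp_pos _)] at hle
  simpa only [pow_two] using hle
end
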